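/- Assume Ĉ := Ĉ(U¹,…,U^J) is invertible and that π̂ is positive and differentiable at U^i. Then for every j ∈ {1,…,J}, the map u ↦ ω^{ij}(u) is differentiable at u = U^i with gradient ∇_u ω^{ij}(U^i) = (ω^{ij}/λ)(Ĉ⁻¹(U^j − Ū^{(i)}) − ∑_{k=1}^J ω^{ik} X^{ik}/2 + X^{ij}/2) + (δ_{ij} − ω^{ij}) α ω^{ii} ∇π̂(U^i)/π̂(U^i), where δ_{ij} is the Kronecker delta and X^{ik} ∈ ℝ^d is defined componentwise by X^{ik}_ℓ := (U^i − U^k)ᵀ Ĉ⁻¹ D_ℓ Ĉ⁻¹ (U^i − U^k) with D_ℓ := J⁻¹((U^i−Ū)e_ℓᵀ + e_ℓ(U^i−Ū)ᵀ). -/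

import Mathlib

open Matrix

noncomputable section

/-- Sample mean `Ū := (1/J)∑ⱼ Uʲ` of an ensemble of `J` particles in `ℝ^d`. -/
def sMean {d J : ℕ} (U : Fin J → Fin d → ℝ) : Fin d → ℝ :=
  (J : ℝ)⁻¹ • ∑ j, U j

/-- Sample covariance `Ĉ(U¹,…,U^J) := (1/J)∑ⱼ (Uʲ−Ū)(Uʲ−Ū)ᵀ`. -/
def sCov {d J : ℕ} (U : Fin J → Fin d → ℝ) : Matrix (Fin d) (Fin d) ℝ :=
  (J : ℝ)⁻¹ • ∑ j, vecMulVec (U j - sMean U) (U j - sMean U)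

/-- `D_ℓ := J⁻¹((Uⁱ−Ū)e_ℓᵀ + e_ℓ(Uⁱ−Ū)ᵀ)`. -/
def Dmat {d J : ℕ} (U : Fin J → Fin d → ℝ) (i : Fin J) (ℓ : Fin d) :
    Matrix (Fin d) (Fin d) ℝ :=
  (J : ℝ)⁻¹ • (vecMulVec (U i - sMean U) (Pi.single ℓ 1) +
    vecMulVec (Pi.single ℓ 1) (U i - sMean U))

/-- The vector `X^{ik}` with components `X^{ik}_ℓ = (Uⁱ−Uᵏ)ᵀ Ĉ⁻¹ D_ℓ Ĉ⁻¹ (Uⁱ−Uᵏ)`. -/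
def Xvec {d J : ℕ} (U : Fin J → Fin d → ℝ) (i k : Fin J) : Fin d → ℝ :=
  fun ℓ => (U i - U k) ⬝ᵥ (((sCov U)⁻¹ * Dmat U i ℓ * (sCov U)⁻¹) *ᵥ (U i - U k))

/-- Unnormalized localized weight as a function of the position `u` of the `i`-th
particle: `w^{ik}(u) = exp(−(1/(2λ))(u−Vᵏ)ᵀĈ^{(i)}(u)⁻¹(u−Vᵏ)) π̂(Vᵏ)^α` where
`Vᵏ = Uᵏ` for `k ≠ i` and `Vⁱ = u`. -/
def wgtFun {d J : ℕ} (l α : ℝ) (pih : (Fin d → ℝ) → ℝ) (U : Fin J → Fin d → ℝ)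
    (i k : Fin J) (u : Fin d → ℝ) : ℝ :=
  Real.exp (-(1 / (2 * l)) * ((u - Function.update U i u k) ⬝ᵥ
      ((sCov (Function.update U i u))⁻¹ *ᵥ (u - Function.update U i u k)))) *
    pih (Function.update U i u k) ^ α

/-- Normalized localized weight `ω^{ik}(u) = w^{ik}(u)/∑_{k'} w^{ik'}(u)`. -/
def omgFun {d J : ℕ} (l α : ℝ) (pih : (Fin d → ℝ) → ℝ) (U : Fin J → Fin d → ℝ)
    (i k : Fin J) (u : Fin d → ℝ) : ℝ :=
  wgtFun l α pih U i k u / ∑ k', wgtFun l α pih U i k' u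

/-- `ω^{ik} := ω^{ik}(Uⁱ)`. -/
def omg {d J : ℕ} (l α : ℝ) (pih : (Fin d → ℝ) → ℝ) (U : Fin J → Fin d → ℝ)
    (i k : Fin J) : ℝ :=
  omgFun l α pih U i k (U i)

/-- Localized mean `Ū^{(i)} := ∑ⱼ ω^{ij} Uʲ`. -/
def locM {d J : ℕ} (l α : ℝ) (pih : (Fin d → ℝ) → ℝ) (U : Fin J → Fin d → ℝ)
    (i : Fin J) : Fin d → ℝ :=
  ∑ j, omg l α pih U i j • U j

theorem LinearMap.exists_hasFDerivAt_bilin {E F G H : Type*} [NormedAddCommGroup E]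
    [NormedSpace ℝ E] [NormedAddCommGroup F] [NormedSpace ℝ F] [FiniteDimensional ℝ F]
    [NormedAddCommGroup G] [NormedSpace ℝ G] [FiniteDimensional ℝ G]
    [NormedAddCommGroup H] [NormedSpace ℝ H] [FiniteDimensional ℝ H] (B : F →ₗ[ℝ] G →ₗ[ℝ] H)
    {a : E → F} {b : E → G} {a' : E →L[ℝ] F} {b' : E →L[ℝ] G} {x : E}
    (ha : HasFDerivAt a a' x) (hb : HasFDerivAt b b' x) :
    ∃ L : E →L[ℝ] H, HasFDerivAt (fun u => B (a u) (b u)) L x ∧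
      ∀ h, L h = B (a x) (b' h) + B (a' h) (b x) :=
  ⟨_, B.toContinuousBilinearMap.hasFDerivAt_of_bilinear ha hb, fun _ => rfl⟩

theorem sum_sub_sMean {d J : ℕ} (hJ : J ≠ 0) (U : Fin J → Fin d → ℝ) :
    ∑ j, (U j - sMean U) = 0 := by
  rw [Finset.sum_sub_distrib]
  simp [sMean, ← Nat.cast_smul_eq_nsmul ℝ, hJ]

theorem hasFDerivAt_update_apply {d J : ℕ} (U : Fin J → Fin d → ℝ) (i k : Fin J)
    (x : Fin d → ℝ) :
    HasFDerivAt (fun u => Function.update U i u k)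
      (if i = k then ContinuousLinearMap.id ℝ (Fin d → ℝ) else 0) x := by
  obtain rfl | hik := eq_or_ne i k
  · simpa using hasFDerivAt_id (𝕜 := ℝ) x
  · simpa only [Function.update_of_ne hik.symm, if_neg hik] using hasFDerivAt_const (U k) x

open scoped Matrix.Norms.Operator in
theorem hasFDerivAt_sCov_update {d J : ℕ} (U : Fin J → Fin d → ℝ) (i : Fin J) :
    ∃ D : (Fin d → ℝ) →L[ℝ] Matrix (Fin d) (Fin d) ℝ,
      HasFDerivAt (fun u => sCov (Function.update U i u)) D (U i) ∧
      ∀ h, D h = (J : ℝ)⁻¹ • (vecMulVec (U i - sMean U) h + vecMulVec h (U i - sMean U)) := by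
  have hmean : HasFDerivAt (fun u => sMean (Function.update U i u))
      ((J : ℝ)⁻¹ • ContinuousLinearMap.id ℝ (Fin d → ℝ)) (U i) := by
    simpa [sMean] using! (HasFDerivAt.fun_sum fun k (_ : k ∈ Finset.univ) =>
      hasFDerivAt_update_apply U i k (U i)).const_smul (J : ℝ)⁻¹
  have hdev (k : Fin J) := (hasFDerivAt_update_apply U i k (U i)).sub hmean
  choose L hL hL' using fun k : Fin J =>
    (vecMulVecBilin ℝ ℝ : (Fin d → ℝ) →ₗ[ℝ] (Fin d → ℝ) →ₗ[ℝ] Matrix (Fin d) (Fin d) ℝ)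
      |>.exists_hasFDerivAt_bilin (hdev k) (hdev k)
  refine ⟨_, (HasFDerivAt.fun_sum fun k (_ : k ∈ Finset.univ) => hL k).const_smul (J : ℝ)⁻¹,
    fun h => ?_⟩
  have hleft (w : Fin d → ℝ) : ∑ k, vecMulVec (U k - sMean U) w = 0 := by
    simp_rw [← vecMulVecBilin_apply_apply ℝ ℝ]
    rw [← LinearMap.sum_apply, ← map_sum, sum_sub_sMean i.pos.ne', map_zero, LinearMap.zero_apply]
  have hright (w : Fin d → ℝ) : ∑ k, vecMulVec w (U k - sMean U) = 0 := by
    simp_rw [← vecMulVecBilin_apply_apply ℝ ℝ]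
    rw [← map_sum, sum_sub_sMean i.pos.ne', map_zero]
  have hite (k : Fin J) : (if i = k then ContinuousLinearMap.id ℝ (Fin d → ℝ) else 0) h =
      if i = k then h else 0 := by
    split_ifs <;> rfl
  have hl (k : Fin J) : vecMulVec (U k - sMean U) (if i = k then h else 0) =
      if i = k then vecMulVec (U k - sMean U) h else 0 := by
    split_ifs <;> simp
  have hr (k : Fin J) : vecMulVec (if i = k then h else 0) (U k - sMean U) =
      if i = k then vecMulVec h (U k - sMean U) else 0 := by
    split_ifs <;> simp
  change (J : ℝ)⁻¹ • (∑ k, L k) h = _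
  erw [_root_.sum_apply]
  have hL'' (k : Fin J) : L k h =
      vecMulVec (U k - sMean U) ((if i = k then h else 0) - (J : ℝ)⁻¹ • h) +
        vecMulVec ((if i = k then h else 0) - (J : ℝ)⁻¹ • h) (U k - sMean U) := by
    simp only [hL', hite, vecMulVecBilin_apply_apply, _root_.sub_apply, _root_.smul_apply,
      Pi.sub_apply, Function.update_eq_self, ContinuousLinearMap.id_apply]
  simp only [hL'', vecMulVec_sub (U _ - _), sub_vecMulVec _ _ (U _ - _),
    Finset.sum_add_distrib, Finset.sum_sub_distrib, hleft, hright, hl, hr]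
  simp

open scoped Matrix.Norms.Operator in
theorem Matrix.exists_hasFDerivAt_inv {E : Type*} [NormedAddCommGroup E] [NormedSpace ℝ E]
    {n : ℕ} {M : E → Matrix (Fin n) (Fin n) ℝ} {M' : E →L[ℝ] Matrix (Fin n) (Fin n) ℝ} {x : E}
    (hM : HasFDerivAt M M' x) (hdet : IsUnit (M x).det) :
    ∃ L : E →L[ℝ] Matrix (Fin n) (Fin n) ℝ, HasFDerivAt (fun u => (M u)⁻¹) L x ∧
      ∀ h, L h = -((M x)⁻¹ * M' h * (M x)⁻¹) := by
  obtain ⟨A, hA⟩ := (isUnit_iff_isUnit_det (M x)).2 hdet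
  have hinv := hasFDerivAt_ringInverse (𝕜 := ℝ) A
  rw [hA] at hinv
  refine ⟨_, by simpa only [nonsing_inv_eq_ringInverse] using! hinv.comp x hM, fun h => ?_⟩
  rw [← hA, ← coe_units_inv]
  rfl

open scoped Matrix.Norms.Operator in
theorem hasFDerivAt_dotProduct_mulVec_inv {E : Type*} [NormedAddCommGroup E] [NormedSpace ℝ E]
    {n : ℕ} {v : E → Fin n → ℝ} {v' : E →L[ℝ] Fin n → ℝ} {M : E → Matrix (Fin n) (Fin n) ℝ}
    {M' : E →L[ℝ] Matrix (Fin n) (Fin n) ℝ} {x : E} (hv : HasFDerivAt v v' x)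
    (hM : HasFDerivAt M M' x) (hdet : IsUnit (M x).det) (hsymm : (M x).IsSymm) :
    ∃ L : E →L[ℝ] ℝ, HasFDerivAt (fun u => v u ⬝ᵥ ((M u)⁻¹ *ᵥ v u)) L x ∧
      ∀ h, L h = 2 * (v' h ⬝ᵥ ((M x)⁻¹ *ᵥ v x)) -
        v x ⬝ᵥ (((M x)⁻¹ * M' h * (M x)⁻¹) *ᵥ v x) := by
  obtain ⟨N, hN, hN'⟩ := Matrix.exists_hasFDerivAt_inv hM hdet
  obtain ⟨L₁, hL₁, hL₁'⟩ := (mulVecBilin ℝ ℝ).exists_hasFDerivAt_bilin hN hv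
  obtain ⟨L, hL, hL'⟩ := (dotProductBilin ℝ ℝ).exists_hasFDerivAt_bilin hv hL₁
  refine ⟨L, hL, fun h => ?_⟩
  have hsymm' : v x ⬝ᵥ ((M x)⁻¹ *ᵥ v' h) = v' h ⬝ᵥ ((M x)⁻¹ *ᵥ v x) := by
    rw [dotProduct_mulVec, ← mulVec_transpose, transpose_nonsing_inv, hsymm.eq, dotProduct_comm]
  simp [hL', hL₁', hsymm', dotProduct_add]
  erw [hN']
  rw [neg_mulVec, dotProduct_neg]
  ring

theorem sCov_isSymm {d J : ℕ} (U : Fin J → Fin d → ℝ) : (sCov U).IsSymm := by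
  simp [IsSymm, sCov, transpose_sum, transpose_vecMulVec]

theorem hasFDerivAt_wgtFun {d J : ℕ} {l α : ℝ} (hl : l ≠ 0) {pih : (Fin d → ℝ) → ℝ}
    {U : Fin J → Fin d → ℝ} {i : Fin J} (hpos : 0 < pih (U i)) (hC : IsUnit (sCov U).det)
    (hdiff : DifferentiableAt ℝ pih (U i)) (k : Fin J) :
    ∃ L : (Fin d → ℝ) →L[ℝ] ℝ, HasFDerivAt (wgtFun l α pih U i k) L (U i) ∧
      ∀ ℓ, L (Pi.single ℓ 1) = wgtFun l α pih U i k (U i) *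
        (l⁻¹ * (((sCov U)⁻¹ *ᵥ (U k - U i)) ℓ + 2⁻¹ * Xvec U i k ℓ) +
          (if i = k then 1 else 0) * (α * (pih (U i))⁻¹ * fderiv ℝ pih (U i) (Pi.single ℓ 1))) := by
  obtain ⟨D, hD, hD'⟩ := hasFDerivAt_sCov_update U i
  have hX (ℓ : Fin d) : Xvec U i k ℓ =
      (U i - U k) ⬝ᵥ (((sCov U)⁻¹ * D (Pi.single ℓ 1) * (sCov U)⁻¹) *ᵥ (U i - U k)) := by
    rw [hD', Xvec, Dmat]
  obtain rfl | hik := eq_or_ne i k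
  · have hw : wgtFun l α pih U i i = fun u => pih u ^ α := by
      ext u
      simp [wgtFun]
    rw [hw]
    refine ⟨_, hdiff.hasFDerivAt.rpow_const (Or.inl hpos.ne'), fun ℓ => ?_⟩
    simp [Xvec, Real.rpow_sub_one hpos.ne']
    ring
  · have hw : wgtFun l α pih U i k = fun u => Real.exp (-(1 / (2 * l)) * ((u - U k) ⬝ᵥ
        ((sCov (Function.update U i u))⁻¹ *ᵥ (u - U k)))) * pih (U k) ^ α := by
      ext u
      simp [wgtFun, hik.symm]
    obtain ⟨Q, hQ, hQ'⟩ := hasFDerivAt_dotProduct_mulVec_inv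
      ((hasFDerivAt_id (𝕜 := ℝ) (U i)).sub_const (U k)) hD (by simpa using hC)
      (sCov_isSymm _)
    simp only [Function.update_eq_self, id_eq] at hQ'
    rw [hw]
    refine ⟨_, ((hQ.const_mul (-(1 / (2 * l)))).exp.mul_const (pih (U k) ^ α)), fun ℓ => ?_⟩
    rw [← neg_sub (U i), mulVec_neg]
    simp [hQ', hX, hik]
    field_simp
    ring

/-- The map `u ↦ ω^{ij}(u)` is differentiable at `u = Uⁱ`, with gradient
`∇ω^{ij} = (ω^{ij}/λ)(Ĉ⁻¹(Uʲ−Ū^{(i)}) − ∑ₖ ω^{ik}X^{ik}/2 + X^{ij}/2)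
  + (δ_{ij} − ω^{ij}) α ω^{ii} ∇π̂(Uⁱ)/π̂(Uⁱ)`. -/
theorem omega_gradient {d J : ℕ} (hd : 1 ≤ d) (hJ : 1 ≤ J)
    (l α : ℝ) (hl : 0 < l) (hα : 0 ≤ α)
    (pih : (Fin d → ℝ) → ℝ) (hpos : ∀ v, 0 < pih v)
    (U : Fin J → Fin d → ℝ) (i : Fin J) (hC : IsUnit (sCov U).det)
    (hdiff : DifferentiableAt ℝ pih (U i)) (j : Fin J) :
    DifferentiableAt ℝ (fun u => omgFun l α pih U i j u) (U i) ∧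
      (fun ℓ => fderiv ℝ (fun u => omgFun l α pih U i j u) (U i) (Pi.single ℓ 1)) =
        (omg l α pih U i j / l) •
            ((sCov U)⁻¹ *ᵥ (U j - locM l α pih U i) -
              ∑ k, omg l α pih U i k • ((2 : ℝ)⁻¹ • Xvec U i k) +
              (2 : ℝ)⁻¹ • Xvec U i j) +
          (((if i = j then (1 : ℝ) else 0) - omg l α pih U i j) * α * omg l α pih U i i) •
            ((pih (U i))⁻¹ • fun ℓ => fderiv ℝ pih (U i) (Pi.single ℓ 1)) := by
  choose L hL hL' using hasFDerivAt_wgtFun (α := α) hl.ne' (hpos (U i)) hC hdiff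
  have hS : 0 < ∑ k, wgtFun l α pih U i k (U i) :=
    Finset.sum_pos (fun k _ => mul_pos (Real.exp_pos _) (Real.rpow_pos_of_pos (hpos _) _))
      ⟨i, Finset.mem_univ i⟩
  have hω := (hL j).mul ((hasDerivAt_inv hS.ne').comp_hasFDerivAt (U i)
    (HasFDerivAt.fun_sum fun k (_ : k ∈ Finset.univ) => hL k))
  refine ⟨hω.differentiableAt, funext fun ℓ => ?_⟩
  rw [show fderiv ℝ (fun u => omgFun l α pih U i j u) (U i) = _ from hω.fderiv]
  have hw (k : Fin J) : wgtFun l α pih U i k (U i) =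
      omg l α pih U i k * ∑ k, wgtFun l α pih U i k (U i) := by
    rw [omg, omgFun, div_mul_cancel₀ _ hS.ne']
  have hone : ∑ k, omg l α pih U i k = 1 := by
    simp only [omg, omgFun, ← Finset.sum_div, div_self hS.ne']
  generalize hSum : ∑ k, wgtFun l α pih U i k (U i) = S at hS hw
  have hsum : ∑ k, L k (Pi.single ℓ 1) =
      S * (l⁻¹ * (∑ k, omg l α pih U i k * ((sCov U)⁻¹ *ᵥ U k) ℓ - ((sCov U)⁻¹ *ᵥ U i) ℓ +
        ∑ k, omg l α pih U i k * (2⁻¹ * Xvec U i k ℓ)) +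
        omg l α pih U i i * (α * (pih (U i))⁻¹ * fderiv ℝ pih (U i) (Pi.single ℓ 1))) := by
    have hi : ((sCov U)⁻¹ *ᵥ U i) ℓ = ∑ k, omg l α pih U i k * ((sCov U)⁻¹ *ᵥ U i) ℓ := by
      rw [← Finset.sum_mul, hone, one_mul]
    have hδ (P : ℝ) : omg l α pih U i i * P =
        ∑ k, omg l α pih U i k * ((if i = k then 1 else 0) * P) := by
      simp
    rw [hi, hδ, ← Finset.sum_sub_distrib, ← Finset.sum_add_distrib, Finset.mul_sum,
      ← Finset.sum_add_distrib, Finset.mul_sum]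
    refine Finset.sum_congr rfl fun k _ => ?_
    rw [hL', hw, mulVec_sub, Pi.sub_apply]
    ring
  simp only [_root_.add_apply, _root_.smul_apply, _root_.sum_apply, hsum,
    smul_eq_mul, Function.comp_apply, hL' j, locM, mulVec_sub, mulVec_sum, mulVec_smul,
    Pi.add_apply, Pi.sub_apply, Pi.smul_apply, Finset.sum_apply, hSum, hw j]
  obtain rfl | hij := eq_or_ne i j
  · simp only [if_true]
    field_simp
    ring
  · simp only [if_neg hij]
    field_simp
    ring
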